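/- In any AG-group G, ((a*b)*c)*d = a*((b*c)*d) for all a,b,c,d in G. -/

import Mathlib

class AGGroup (G : Type*) extends Mul G, Inv G where
  e : G
  left_id : ∀ a : G, e * a = a
  inv_mul : ∀ a : G, a⁻¹ * a = e
  mul_inv : ∀ a : G, a * a⁻¹ = e
  left_invertive : ∀ x y z : G, (x * y) * z = (z * y) * x

def AGPar {G : Type*} [AGGroup G] (a b c d : G) : Prop :=
  ∃ p q : G, p * a = q * b ∧ p * d = q * c

theorem ag_medial {G : Type*} [AGGroup G] (a b c d : G) :
    (a * b) * (c * d) = (a * c) * (b * d) := by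
  rw [AGGroup.left_invertive a b (c * d), AGGroup.left_invertive c d b,
    AGGroup.left_invertive (b * d) c a]

theorem ag_left_comm {G : Type*} [AGGroup G] (a b c : G) :
    a * (b * c) = b * (a * c) := by
  have h := ag_medial (AGGroup.e : G) a b c
  rwa [AGGroup.left_id, AGGroup.left_id] at h

theorem stmt11 {G : Type*} [AGGroup G] (a b c d : G) :
    ((a * b) * c) * d = a * ((b * c) * d) := by 
  rw [AGGroup.left_invertive (a * b) c d, ag_left_comm (d * c) a b,
    AGGroup.left_invertive d c b]
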